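/- arXiv:0802.0184 — 12 statements merged into one kernel-verified Lean document; each statement's English description precedes it below -/
import Mathlib

section
/- Let g be a Lie algebra over a field K and let R : g → g be a linear map satisfying the modified Yang–Baxter equation. Then the R-bracket [X,Y]_R := ⁅R(X),Y⁆ + ⁅X,R(Y)⁆ defines a Lie algebra structure on the underlying module of g: it is bilinear, alternating, and satisfies the Jacobi identity. -/
/-- The `R`-bracket `[X,Y]_R := ⁅R X, Y⁆ + ⁅X, R Y⁆` associated to a linear
operator `R` on a Lie algebra. -/
def Rbracket {K : Type*} [Field K] {g : Type*} [LieRing g] [LieAlgebra K g]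
    (R : g →ₗ[K] g) (X Y : g) : g :=
  ⁅R X, Y⁆ + ⁅X, R Y⁆

/-- If `R` satisfies the modified Yang–Baxter equation, then the `R`-bracket is
bilinear, alternating and satisfies the Jacobi identity, i.e. it defines a Lie
algebra structure on the underlying module of `g`. -/
theorem rbracket_isLieBracket {K : Type*} [Field K] {g : Type*} [LieRing g] [LieAlgebra K g]
    (R : g →ₗ[K] g)
    (hR : ∀ X Y : g, R (⁅R X, Y⁆ + ⁅X, R Y⁆) - ⁅R X, R Y⁆ = ⁅X, Y⁆) :
    (∀ X Y Z : g, Rbracket R (X + Y) Z = Rbracket R X Z + Rbracket R Y Z) ∧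
    (∀ (c : K) (X Y : g), Rbracket R (c • X) Y = c • Rbracket R X Y) ∧
    (∀ X Y Z : g, Rbracket R X (Y + Z) = Rbracket R X Y + Rbracket R X Z) ∧
    (∀ (c : K) (X Y : g), Rbracket R X (c • Y) = c • Rbracket R X Y) ∧
    (∀ X : g, Rbracket R X X = 0) ∧
    (∀ X Y Z : g,
      Rbracket R X (Rbracket R Y Z) + Rbracket R Y (Rbracket R Z X) +
        Rbracket R Z (Rbracket R X Y) = 0) := by
  have hR' (X Y : g) : R (⁅R X, Y⁆ + ⁅X, R Y⁆) = ⁅X, Y⁆ + ⁅R X, R Y⁆ :=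
    sub_eq_iff_eq_add.mp (hR X Y)
  refine ⟨fun X Y Z => ?_, fun c X Y => ?_, fun X Y Z => ?_, fun c X Y => ?_, fun X => ?_,
    fun X Y Z => ?_⟩
  · simp only [Rbracket, map_add, add_lie]
    abel
  · simp only [Rbracket, map_smul, smul_lie, smul_add]
  · simp only [Rbracket, map_add, lie_add]
    abel
  · simp only [Rbracket, map_smul, lie_smul, smul_add]
  · rw [Rbracket, ← lie_skew X (R X), add_neg_cancel]
  · have expansion :
        Rbracket R X (Rbracket R Y Z) + Rbracket R Y (Rbracket R Z X) +
            Rbracket R Z (Rbracket R X Y) =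
          (⁅X, ⁅Y, Z⁆⁆ + ⁅Y, ⁅Z, X⁆⁆ + ⁅Z, ⁅X, Y⁆⁆) +
          (⁅R X, ⁅R Y, Z⁆⁆ + ⁅R Y, ⁅Z, R X⁆⁆ + ⁅Z, ⁅R X, R Y⁆⁆) +
          (⁅R X, ⁅Y, R Z⁆⁆ + ⁅Y, ⁅R Z, R X⁆⁆ + ⁅R Z, ⁅R X, Y⁆⁆) +
          (⁅X, ⁅R Y, R Z⁆⁆ + ⁅R Y, ⁅R Z, X⁆⁆ + ⁅R Z, ⁅X, R Y⁆⁆) := by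
      simp only [Rbracket, hR', lie_add]
      abel
    rw [expansion]
    simp only [lie_jacobi, add_zero]
end

section
/- Let g be a Lie algebra over a field K and let R : g → g be a linear map satisfying the modified Yang–Baxter equation. Then for all X,Y ∈ g one has ⁅R₊(X),R₊(Y)⁆ = R₊(⁅R(X),Y⁆ + ⁅X,R(Y)⁆) and ⁅R₋(X),R₋(Y)⁆ = R₋(⁅R(X),Y⁆ + ⁅X,R(Y)⁆). -/
/-- For a classical `R`-operator on a Lie algebra `g` one has
`⁅R₊ X, R₊ Y⁆ = R₊(⁅R X, Y⁆ + ⁅X, R Y⁆)` and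
`⁅R₋ X, R₋ Y⁆ = R₋(⁅R X, Y⁆ + ⁅X, R Y⁆)`, where `R₊ = R + id`, `R₋ = R - id`. -/
theorem bracket_RPlusMinus_eq {K : Type*} [Field K]
    {g : Type*} [LieRing g] [LieAlgebra K g]
    (R : g →ₗ[K] g)
    (hR : ∀ X Y : g, R (⁅R X, Y⁆ + ⁅X, R Y⁆) - ⁅R X, R Y⁆ = ⁅X, Y⁆) :
    ∀ X Y : g,
      ⁅(R + LinearMap.id : g →ₗ[K] g) X, (R + LinearMap.id : g →ₗ[K] g) Y⁆ =
          (R + LinearMap.id : g →ₗ[K] g) (⁅R X, Y⁆ + ⁅X, R Y⁆) ∧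
      ⁅(R - LinearMap.id : g →ₗ[K] g) X, (R - LinearMap.id : g →ₗ[K] g) Y⁆ =
          (R - LinearMap.id : g →ₗ[K] g) (⁅R X, Y⁆ + ⁅X, R Y⁆) := by
  intro X Y
  have h : R (⁅R X, Y⁆ + ⁅X, R Y⁆) = ⁅X, Y⁆ + ⁅R X, R Y⁆ := sub_eq_iff_eq_add.mp (hR X Y)
  simp only [LinearMap.add_apply, LinearMap.sub_apply, LinearMap.id_apply, h,
    add_lie, lie_add, sub_lie, lie_sub]
  constructor <;> abel
end

section
/- Let g be a Lie algebra over a field K, let R : g → g satisfy the modified Yang–Baxter equation, and let L : g → K be a linear functional. Suppose X,Y ∈ g satisfy (L ∘ R₊)(⁅X,Z⁆) = 0 and (L ∘ R₊)(⁅Y,Z⁆) = 0 for all Z ∈ g (i.e. X and Y are critical directions of an invariant evaluated at R₊*(L)). Then L(⁅R₊(X),R₊(Y)⁆) = 0. (This is the pointwise form of part (i) of the main theorem: the functions I_k^{R₊}(L) = I_k(R₊*(L)) built from coadjoint invariants I_k pairwise Poisson-commute with respect to the Lie–Poisson bracket on g*.) -/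
/-- Pointwise form of part (i) of the main theorem on commuting integrals built
from a classical `R`-operator: if `X`, `Y` are critical directions of coadjoint
invariants evaluated at `R₊*(L)`, i.e. `L(R₊ ⁅X, Z⁆) = 0` and `L(R₊ ⁅Y, Z⁆) = 0`
for all `Z`, then `L(⁅R₊ X, R₊ Y⁆) = 0`, where `R₊ = R + id`. -/
theorem lie_poisson_commute_plus_plus {K : Type*} [Field K]
    {g : Type*} [LieRing g] [LieAlgebra K g]
    (R : g →ₗ[K] g)
    (hR : ∀ X Y : g, R (⁅R X, Y⁆ + ⁅X, R Y⁆) - ⁅R X, R Y⁆ = ⁅X, Y⁆)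
    (L : Module.Dual K g) (X Y : g)
    (hX : ∀ Z : g, L ((R + LinearMap.id : g →ₗ[K] g) ⁅X, Z⁆) = 0)
    (hY : ∀ Z : g, L ((R + LinearMap.id : g →ₗ[K] g) ⁅Y, Z⁆) = 0) :
    L ⁅(R + LinearMap.id : g →ₗ[K] g) X, (R + LinearMap.id : g →ₗ[K] g) Y⁆ = 0 := by
  have key : ⁅(R + LinearMap.id : g →ₗ[K] g) X, (R + LinearMap.id : g →ₗ[K] g) Y⁆ =
      (R + LinearMap.id : g →ₗ[K] g) ⁅X, R Y⁆ - (R + LinearMap.id : g →ₗ[K] g) ⁅Y, R X⁆ := by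
    have h := hR X Y
    rw [← lie_skew (R X) Y] at h
    simp only [LinearMap.add_apply, LinearMap.id_apply, lie_add, add_lie, map_add, map_neg,
      ← lie_skew (R X) Y] at h ⊢
    rw [← h]
    abel
  rw [key, map_sub, hX, hY, sub_zero]
end

section
/- Let g be a Lie algebra over a field K, let R : g → g satisfy the modified Yang–Baxter equation, and let L : g → K be a linear functional. Suppose X,Y ∈ g satisfy (L ∘ R₋)(⁅X,Z⁆) = 0 and (L ∘ R₋)(⁅Y,Z⁆) = 0 for all Z ∈ g. Then L(⁅R₋(X),R₋(Y)⁆) = 0. (This is the pointwise form of part (ii) of the main theorem: the functions I_k^{R₋}(L) = I_k(R₋*(L)) built from coadjoint invariants pairwise Poisson-commute with respect to the Lie–Poisson bracket on g*.) -/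
/-- For a solution `R` of the modified Yang–Baxter equation, `R₋ = R - id` is a homomorphism from
the `R`-bracket `⁅R X, Y⁆ + ⁅X, R Y⁆` to the original bracket. -/
theorem lie_sub_id_sub_id_of_modifiedYangBaxter {K g : Type*} [CommRing K] [LieRing g]
    [LieAlgebra K g] (R : g →ₗ[K] g)
    (hR : ∀ X Y : g, R (⁅R X, Y⁆ + ⁅X, R Y⁆) - ⁅R X, R Y⁆ = ⁅X, Y⁆) (X Y : g) :
    ⁅(R - LinearMap.id : g →ₗ[K] g) X, (R - LinearMap.id : g →ₗ[K] g) Y⁆ =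
      (R - LinearMap.id : g →ₗ[K] g) (⁅R X, Y⁆ + ⁅X, R Y⁆) := by
  simp only [LinearMap.sub_apply, LinearMap.id_apply, lie_sub, sub_lie, ← hR X Y]
  abel

/-- Pointwise form of part (ii) of the main theorem on commuting integrals built
from a classical `R`-operator: if `L(R₋ ⁅X, Z⁆) = 0` and `L(R₋ ⁅Y, Z⁆) = 0`
for all `Z`, then `L(⁅R₋ X, R₋ Y⁆) = 0`, where `R₋ = R - id`. -/
theorem lie_poisson_commute_minus_minus {K : Type*} [Field K]
    {g : Type*} [LieRing g] [LieAlgebra K g]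
    (R : g →ₗ[K] g)
    (hR : ∀ X Y : g, R (⁅R X, Y⁆ + ⁅X, R Y⁆) - ⁅R X, R Y⁆ = ⁅X, Y⁆)
    (L : Module.Dual K g) (X Y : g)
    (hX : ∀ Z : g, L ((R - LinearMap.id : g →ₗ[K] g) ⁅X, Z⁆) = 0)
    (hY : ∀ Z : g, L ((R - LinearMap.id : g →ₗ[K] g) ⁅Y, Z⁆) = 0) :
    L ⁅(R - LinearMap.id : g →ₗ[K] g) X, (R - LinearMap.id : g →ₗ[K] g) Y⁆ = 0 := by
  rw [lie_sub_id_sub_id_of_modifiedYangBaxter R hR, ← lie_skew, map_add, map_add, map_neg, map_neg,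
    hX, hY, neg_zero, add_zero]
end

section
/- Let g be a Lie algebra over a field K, let R : g → g satisfy the modified Yang–Baxter equation, and let L : g → K be a linear functional. Suppose X,Y ∈ g satisfy (L ∘ R₊)(⁅X,Z⁆) = 0 for all Z ∈ g and (L ∘ R₋)(⁅Y,Z⁆) = 0 for all Z ∈ g. Then L(⁅R₊(X),R₋(Y)⁆) = 0. (This is the pointwise form of part (iii) of the main theorem: the functions I_k^{R₊}(L) = I_k(R₊*(L)) Poisson-commute with the functions I_l^{R₋}(L) = I_l(R₋*(L)) with respect to the Lie–Poisson bracket on g*.) -/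
/-- The modified Yang–Baxter equation expressed through `R₊ = R + id` and `R₋ = R - id`. -/
theorem lie_plus_minus_eq {K : Type*} [CommRing K]
    {g : Type*} [LieRing g] [LieAlgebra K g]
    (R : g →ₗ[K] g)
    (hR : ∀ X Y : g, R (⁅R X, Y⁆ + ⁅X, R Y⁆) - ⁅R X, R Y⁆ = ⁅X, Y⁆) (X Y : g) :
    ⁅(R + LinearMap.id : g →ₗ[K] g) X, (R - LinearMap.id : g →ₗ[K] g) Y⁆ =
      (R + LinearMap.id : g →ₗ[K] g) ⁅X, (R - LinearMap.id : g →ₗ[K] g) Y⁆ -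
      (R - LinearMap.id : g →ₗ[K] g) ⁅Y, (R + LinearMap.id : g →ₗ[K] g) X⁆ := by
  have h := sub_eq_iff_eq_add.mp (hR X Y)
  rw [← lie_skew Y, map_neg, sub_neg_eq_add]
  simp only [LinearMap.add_apply, LinearMap.sub_apply, LinearMap.id_apply, add_lie, lie_sub,
    map_add, map_sub] at h ⊢
  rw [← sub_eq_iff_eq_add'.mpr h]
  abel


/-- Pointwise form of part (iii) of the main theorem on commuting integrals built
from a classical `R`-operator: if `L(R₊ ⁅X, Z⁆) = 0` for all `Z` and
`L(R₋ ⁅Y, Z⁆) = 0` for all `Z`, then `L(⁅R₊ X, R₋ Y⁆) = 0`,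
where `R₊ = R + id` and `R₋ = R - id`. -/
theorem lie_poisson_commute_plus_minus {K : Type*} [Field K]
    {g : Type*} [LieRing g] [LieAlgebra K g]
    (R : g →ₗ[K] g)
    (hR : ∀ X Y : g, R (⁅R X, Y⁆ + ⁅X, R Y⁆) - ⁅R X, R Y⁆ = ⁅X, Y⁆)
    (L : Module.Dual K g) (X Y : g)
    (hX : ∀ Z : g, L ((R + LinearMap.id : g →ₗ[K] g) ⁅X, Z⁆) = 0)
    (hY : ∀ Z : g, L ((R - LinearMap.id : g →ₗ[K] g) ⁅Y, Z⁆) = 0) :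
    L ⁅(R + LinearMap.id : g →ₗ[K] g) X, (R - LinearMap.id : g →ₗ[K] g) Y⁆ = 0 := by
  rw [lie_plus_minus_eq R hR, map_sub, hX, hY, sub_zero]
end

section
/- Let g be a Lie algebra over a field K and let g₊, g₋ be Lie subalgebras of g whose underlying submodules are complementary (g = g₊ ⊕ g₋ as a direct sum of K-submodules). Let P₊ and P₋ be the corresponding projection operators onto g₊ and g₋. Then the Kostant–Adler–Symes operator R := P₊ − P₋ satisfies the modified Yang–Baxter equation on g. -/
/-- The Kostant–Adler–Symes operator `R = P₊ - P₋` associated to a decomposition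
of `g` into two complementary Lie subalgebras `g₊`, `g₋`, where `P₊`, `P₋` are
the corresponding projections. -/
noncomputable def kasR {K : Type*} [Field K] {g : Type*} [LieRing g] [LieAlgebra K g]
    (gp gm : LieSubalgebra K g) (h : IsCompl gp.toSubmodule gm.toSubmodule) :
    g →ₗ[K] g :=
  gp.toSubmodule.subtype ∘ₗ gp.toSubmodule.linearProjOfIsCompl gm.toSubmodule h
    - gm.toSubmodule.subtype ∘ₗ gm.toSubmodule.linearProjOfIsCompl gp.toSubmodule h.symm

theorem kasR_apply_of_mem_left {K : Type*} [Field K] {g : Type*} [LieRing g] [LieAlgebra K g]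
    (gp gm : LieSubalgebra K g) (h : IsCompl gp.toSubmodule gm.toSubmodule)
    {x : g} (hx : x ∈ gp) : kasR gp gm h x = x := by
  have h₁ := Submodule.projectionOnto_apply_left h ⟨x, hx⟩
  have h₂ := Submodule.projectionOnto_apply_right h.symm ⟨x, hx⟩
  change (gp.toSubmodule.projectionOnto gm.toSubmodule h x : g) -
    (gm.toSubmodule.projectionOnto gp.toSubmodule h.symm x : g) = x
  rw [h₁, h₂]
  simp

theorem kasR_apply_of_mem_right {K : Type*} [Field K] {g : Type*} [LieRing g] [LieAlgebra K g]
    (gp gm : LieSubalgebra K g) (h : IsCompl gp.toSubmodule gm.toSubmodule)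
    {x : g} (hx : x ∈ gm) : kasR gp gm h x = -x := by
  have h₁ := Submodule.projectionOnto_apply_right h ⟨x, hx⟩
  have h₂ := Submodule.projectionOnto_apply_left h.symm ⟨x, hx⟩
  change (gp.toSubmodule.projectionOnto gm.toSubmodule h x : g) -
    (gm.toSubmodule.projectionOnto gp.toSubmodule h.symm x : g) = -x
  rw [h₁, h₂]
  simp

/-- If `g = g₊ ⊕ g₋` is a direct sum of two Lie subalgebras (as `K`-submodules),
then the Kostant–Adler–Symes operator `R = P₊ - P₋` satisfies the modified
Yang–Baxter equation on `g`. -/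
theorem kasR_satisfies_mybe {K : Type*} [Field K] {g : Type*} [LieRing g] [LieAlgebra K g]
    (gp gm : LieSubalgebra K g) (h : IsCompl gp.toSubmodule gm.toSubmodule) :
    ∀ X Y : g,
      kasR gp gm h (⁅kasR gp gm h X, Y⁆ + ⁅X, kasR gp gm h Y⁆) -
          ⁅kasR gp gm h X, kasR gp gm h Y⁆ = ⁅X, Y⁆ := by
  intro X Y
  obtain ⟨a, ha, b, hb, rfl⟩ := Submodule.mem_sup.1 (h.sup_eq_top ▸ Submodule.mem_top (x := X))
  obtain ⟨c, hc, d, hd, rfl⟩ := Submodule.mem_sup.1 (h.sup_eq_top ▸ Submodule.mem_top (x := Y))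
  have hac : ⁅a, c⁆ ∈ gp := gp.lie_mem ha hc
  have hbd : ⁅b, d⁆ ∈ gm := gm.lie_mem hb hd
  have key : ⁅a + -b, c + d⁆ + ⁅a + b, c + -d⁆ = ⁅a, c⁆ + ⁅a, c⁆ - (⁅b, d⁆ + ⁅b, d⁆) := by
    simp only [add_lie, lie_add, neg_lie, lie_neg]
    abel
  rw [map_add (kasR gp gm h) a b, map_add (kasR gp gm h) c d,
    kasR_apply_of_mem_left gp gm h ha, kasR_apply_of_mem_right gp gm h hb,
    kasR_apply_of_mem_left gp gm h hc, kasR_apply_of_mem_right gp gm h hd, key,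
    map_sub, map_add, map_add, kasR_apply_of_mem_left gp gm h hac,
    kasR_apply_of_mem_right gp gm h hbd]
  simp only [add_lie, lie_add, neg_lie, lie_neg]
  abel
end

section
/- Let g be a Lie algebra over a field K with a triangular decomposition g = g₊ ⊕ g₀ ⊕ g₋ (a direct sum of K-submodules) in which g₊, g₀, g₋ are Lie subalgebras and ⁅g₀, g₊⁆ ⊆ g₊ and ⁅g₀, g₋⁆ ⊆ g₋ (g₊ and g₋ are g₀-modules). Let P₊, P₀, P₋ be the corresponding projections, and let R₀ : g₀ → g₀ be a linear map satisfying the modified Yang–Baxter equation on the Lie algebra g₀. Then R := P₊ + R₀ ∘ P₀ − P₋ satisfies the modified Yang–Baxter equation on g. -/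
/-- The triangular operator `R = P₊ + R₀ ∘ P₀ - P₋` associated to a triangular
decomposition `g = g₊ ⊕ g₀ ⊕ g₋` with projections `Pp`, `P0`, `Pm` and a linear
operator `R₀` on `g₀`. -/
def triangularR {K : Type*} [Field K] {g : Type*} [LieRing g] [LieAlgebra K g]
    (g0 : LieSubalgebra K g) (Pp P0 Pm : g →ₗ[K] g)
    (R0 : ↥g0 →ₗ[K] ↥g0) (hP0 : ∀ x : g, P0 x ∈ g0) : g → g :=
  fun x => Pp x + ((R0 ⟨P0 x, hP0 x⟩ : ↥g0) : g) - Pm x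

/-- The operator `R` acts componentwise on a sum `p + z + m` with `p ∈ g₊`, `z ∈ g₀`, `m ∈ g₋`. -/
theorem triangularR_add_add {K : Type*} [Field K]
    {g : Type*} [LieRing g] [LieAlgebra K g]
    (gp g0 gm : LieSubalgebra K g) (Pp P0 Pm : g →ₗ[K] g)
    (hP0mem : ∀ x : g, P0 x ∈ g0)
    (hProjp : ∀ x ∈ gp, Pp x = x ∧ P0 x = 0 ∧ Pm x = 0)
    (hProj0 : ∀ x ∈ g0, Pp x = 0 ∧ P0 x = x ∧ Pm x = 0)
    (hProjm : ∀ x ∈ gm, Pp x = 0 ∧ P0 x = 0 ∧ Pm x = x)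
    (R0 : ↥g0 →ₗ[K] ↥g0) {p m : g} (hp : p ∈ gp) (z : ↥g0) (hm : m ∈ gm) :
    triangularR g0 Pp P0 Pm R0 hP0mem (p + z + m) = p + R0 z - m := by
  obtain ⟨p1, p2, p3⟩ := hProjp p hp
  obtain ⟨z1, z2, z3⟩ := hProj0 z z.2
  obtain ⟨m1, m2, m3⟩ := hProjm m hm
  simp [triangularR, p1, p2, p3, z1, z2, z3, m1, m2, m3]

/-- Given a triangular decomposition `g = g₊ ⊕ g₀ ⊕ g₋` into Lie subalgebras with
`⁅g₀, g₊⁆ ⊆ g₊`, `⁅g₀, g₋⁆ ⊆ g₋`, and a solution `R₀` of the modified Yang–Baxter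
equation on `g₀`, the operator `R = P₊ + R₀ ∘ P₀ - P₋` satisfies the modified
Yang–Baxter equation on `g`. -/
theorem triangularR_satisfies_mybe {K : Type*} [Field K]
    {g : Type*} [LieRing g] [LieAlgebra K g]
    (gp g0 gm : LieSubalgebra K g) (Pp P0 Pm : g →ₗ[K] g)
    (hsum : ∀ x : g, Pp x + P0 x + Pm x = x)
    (hPpmem : ∀ x : g, Pp x ∈ gp) (hP0mem : ∀ x : g, P0 x ∈ g0)
    (hPmmem : ∀ x : g, Pm x ∈ gm)
    (hProjp : ∀ x ∈ gp, Pp x = x ∧ P0 x = 0 ∧ Pm x = 0)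
    (hProj0 : ∀ x ∈ g0, Pp x = 0 ∧ P0 x = x ∧ Pm x = 0)
    (hProjm : ∀ x ∈ gm, Pp x = 0 ∧ P0 x = 0 ∧ Pm x = x)
    (hmodp : ∀ x ∈ g0, ∀ y ∈ gp, ⁅x, y⁆ ∈ gp)
    (hmodm : ∀ x ∈ g0, ∀ y ∈ gm, ⁅x, y⁆ ∈ gm)
    (R0 : ↥g0 →ₗ[K] ↥g0)
    (hR0 : ∀ X Y : ↥g0, R0 (⁅R0 X, Y⁆ + ⁅X, R0 Y⁆) - ⁅R0 X, R0 Y⁆ = ⁅X, Y⁆) :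
    ∀ X Y : g,
      triangularR g0 Pp P0 Pm R0 hP0mem
          (⁅triangularR g0 Pp P0 Pm R0 hP0mem X, Y⁆ +
            ⁅X, triangularR g0 Pp P0 Pm R0 hP0mem Y⁆) -
        ⁅triangularR g0 Pp P0 Pm R0 hP0mem X, triangularR g0 Pp P0 Pm R0 hP0mem Y⁆ =
        ⁅X, Y⁆ := by
  intro X Y
  have hR := @triangularR_add_add K _ g _ _ gp g0 gm Pp P0 Pm hP0mem hProjp hProj0 hProjm R0
  have hmodp' : ∀ x ∈ gp, ∀ y ∈ g0, ⁅x, y⁆ ∈ gp := fun x hx y hy => by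
    rw [← lie_skew]; exact neg_mem (hmodp y hy x hx)
  have hmodm' : ∀ x ∈ gm, ∀ y ∈ g0, ⁅x, y⁆ ∈ gm := fun x hx y hy => by
    rw [← lie_skew]; exact neg_mem (hmodm y hy x hx)
  obtain ⟨a, ha, b, c, hc, rfl⟩ : ∃ a ∈ gp, ∃ b : ↥g0, ∃ c ∈ gm, a + (b : g) + c = X :=
    ⟨Pp X, hPpmem X, ⟨P0 X, hP0mem X⟩, Pm X, hPmmem X, hsum X⟩
  obtain ⟨d, hd, e, f, hf, rfl⟩ : ∃ d ∈ gp, ∃ e : ↥g0, ∃ f ∈ gm, d + (e : g) + f = Y :=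
    ⟨Pp Y, hPpmem Y, ⟨P0 Y, hP0mem Y⟩, Pm Y, hPmmem Y, hsum Y⟩
  rw [hR ha b hc, hR hd e hf]
  have hp : ⁅a, d⁆ + ⁅a, d⁆ + ⁅a, (e : g)⁆ + ⁅a, (R0 e : g)⁆ + ⁅(b : g), d⁆ + ⁅(R0 b : g), d⁆
      ∈ gp :=
    add_mem (add_mem (add_mem (add_mem (add_mem (gp.lie_mem ha hd) (gp.lie_mem ha hd))
      (hmodp' a ha e e.2)) (hmodp' a ha _ (R0 e).2)) (hmodp b b.2 d hd)) (hmodp _ (R0 b).2 d hd)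
  have hm : ⁅(R0 b : g), f⁆ + ⁅c, (R0 e : g)⁆ - ⁅(b : g), f⁆ - ⁅c, (e : g)⁆ - ⁅c, f⁆ - ⁅c, f⁆
      ∈ gm :=
    sub_mem (sub_mem (sub_mem (sub_mem (add_mem (hmodm _ (R0 b).2 f hf) (hmodm' c hc _ (R0 e).2))
      (hmodm b b.2 f hf)) (hmodm' c hc e e.2)) (gm.lie_mem hc hf)) (gm.lie_mem hc hf)
  have h0 := congrArg (Subtype.val) (sub_eq_iff_eq_add.mp (hR0 b e))
  have key := hR hp (⁅R0 b, e⁆ + ⁅b, R0 e⁆) hm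
  rw [h0] at key
  simp only [AddMemClass.coe_add, LieSubalgebra.coe_bracket] at key
  have hsplit : ⁅a + (R0 b : g) - c, d + (e : g) + f⁆ + ⁅a + (b : g) + c, d + (R0 e : g) - f⁆ =
      (⁅a, d⁆ + ⁅a, d⁆ + ⁅a, (e : g)⁆ + ⁅a, (R0 e : g)⁆ + ⁅(b : g), d⁆ + ⁅(R0 b : g), d⁆)
      + (⁅(R0 b : g), (e : g)⁆ + ⁅(b : g), (R0 e : g)⁆)
      + (⁅(R0 b : g), f⁆ + ⁅c, (R0 e : g)⁆ - ⁅(b : g), f⁆ - ⁅c, (e : g)⁆ - ⁅c, f⁆ - ⁅c, f⁆) := by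
    simp only [lie_add, add_lie, lie_sub, sub_lie]
    abel
  rw [hsplit, key]
  simp only [lie_add, add_lie, lie_sub, sub_lie]
  abel
end

section
/- Let g be a Lie algebra over a field K with a triangular decomposition g = g₊ ⊕ g₀ ⊕ g₋ (a direct sum of K-submodules) in which g₊, g₀, g₋ are Lie subalgebras, ⁅g₀, g₊⁆ ⊆ g₊, ⁅g₀, g₋⁆ ⊆ g₋, and in addition g₀ is abelian (⁅g₀, g₀⁆ = 0). Then for ANY linear map R₀ : g₀ → g₀ the operator R := P₊ + R₀ ∘ P₀ − P₋ satisfies the modified Yang–Baxter equation on g, where P₊, P₀, P₋ are the projections associated with the decomposition. -/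
/-- Given a triangular decomposition `g = g₊ ⊕ g₀ ⊕ g₋` into Lie subalgebras with
`⁅g₀, g₊⁆ ⊆ g₊`, `⁅g₀, g₋⁆ ⊆ g₋`, in which moreover `g₀` is abelian, the operator
`R = P₊ + R₀ ∘ P₀ - P₋` satisfies the modified Yang–Baxter equation on `g` for
ANY linear map `R₀ : g₀ → g₀`. -/
theorem triangularR_abelian_satisfies_mybe {K : Type*} [Field K]
    {g : Type*} [LieRing g] [LieAlgebra K g]
    (gp g0 gm : LieSubalgebra K g) (Pp P0 Pm : g →ₗ[K] g)
    (hsum : ∀ x : g, Pp x + P0 x + Pm x = x)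
    (hPpmem : ∀ x : g, Pp x ∈ gp) (hP0mem : ∀ x : g, P0 x ∈ g0)
    (hPmmem : ∀ x : g, Pm x ∈ gm)
    (hProjp : ∀ x ∈ gp, Pp x = x ∧ P0 x = 0 ∧ Pm x = 0)
    (hProj0 : ∀ x ∈ g0, Pp x = 0 ∧ P0 x = x ∧ Pm x = 0)
    (hProjm : ∀ x ∈ gm, Pp x = 0 ∧ P0 x = 0 ∧ Pm x = x)
    (hmodp : ∀ x ∈ g0, ∀ y ∈ gp, ⁅x, y⁆ ∈ gp)
    (hmodm : ∀ x ∈ g0, ∀ y ∈ gm, ⁅x, y⁆ ∈ gm)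
    (habelian : ∀ x ∈ g0, ∀ y ∈ g0, ⁅x, y⁆ = (0 : g))
    (R0 : ↥g0 →ₗ[K] ↥g0) :
    ∀ X Y : g,
      triangularR g0 Pp P0 Pm R0 hP0mem
          (⁅triangularR g0 Pp P0 Pm R0 hP0mem X, Y⁆ +
            ⁅X, triangularR g0 Pp P0 Pm R0 hP0mem Y⁆) -
        ⁅triangularR g0 Pp P0 Pm R0 hP0mem X, triangularR g0 Pp P0 Pm R0 hP0mem Y⁆ =
        ⁅X, Y⁆ := by
  have hR : ∀ p ∈ gp, ∀ m ∈ gm, triangularR g0 Pp P0 Pm R0 hP0mem (p + m) = p - m := by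
    intro p hp m hm
    obtain ⟨hpp, hp0, hpm⟩ := hProjp p hp
    obtain ⟨hmp, hm0, hmm⟩ := hProjm m hm
    have h0 : (⟨P0 (p + m), hP0mem (p + m)⟩ : ↥g0) = 0 :=
      Subtype.ext (by simp [hp0, hm0])
    rw [triangularR, h0]
    simp [hpp, hpm, hmp, hmm]
  intro X Y
  have hX : triangularR g0 Pp P0 Pm R0 hP0mem X =
      Pp X + ((R0 ⟨P0 X, hP0mem X⟩ : ↥g0) : g) - Pm X := rfl
  have hY : triangularR g0 Pp P0 Pm R0 hP0mem Y =
      Pp Y + ((R0 ⟨P0 Y, hP0mem Y⟩ : ↥g0) : g) - Pm Y := rfl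
  rw [hX, hY]
  clear hX hY
  have hr := (R0 ⟨P0 X, hP0mem X⟩).2
  have hs := (R0 ⟨P0 Y, hP0mem Y⟩).2
  generalize ((R0 ⟨P0 X, hP0mem X⟩ : ↥g0) : g) = r at hr ⊢
  generalize ((R0 ⟨P0 Y, hP0mem Y⟩ : ↥g0) : g) = s at hs ⊢
  have ha := hPpmem X
  have hb := hP0mem X
  have hc := hPmmem X
  have ha' := hPpmem Y
  have hb' := hP0mem Y
  have hc' := hPmmem Y
  have hXs := (hsum X).symm
  have hYs := (hsum Y).symm
  generalize Pp X = a at *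
  generalize P0 X = b at *
  generalize Pm X = c at *
  generalize Pp Y = a' at *
  generalize P0 Y = b' at *
  generalize Pm Y = c' at *
  subst hXs hYs
  have hp : ⁅a, a'⁆ + ⁅a, a'⁆ + ⁅r + b, a'⁆ - ⁅s + b', a⁆ ∈ gp :=
    sub_mem (add_mem (add_mem (gp.lie_mem ha ha') (gp.lie_mem ha ha'))
      (hmodp _ (add_mem hr hb) _ ha')) (hmodp _ (add_mem hs hb') _ ha)
  have hm : ⁅r - b, c'⁆ - ⁅s - b', c⁆ - ⁅c, c'⁆ - ⁅c, c'⁆ ∈ gm :=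
    sub_mem (sub_mem (sub_mem (hmodm _ (sub_mem hr hb) _ hc') (hmodm _ (sub_mem hs hb') _ hc))
      (gm.lie_mem hc hc')) (gm.lie_mem hc hc')
  have hrb := habelian r hr b' hb'
  have hbs := habelian b hb s hs
  have hrs := habelian r hr s hs
  have hbb := habelian b hb b' hb'
  have hZ : ⁅a + r - c, a' + b' + c'⁆ + ⁅a + b + c, a' + s - c'⁆ =
      (⁅a, a'⁆ + ⁅a, a'⁆ + ⁅r + b, a'⁆ - ⁅s + b', a⁆) +
        (⁅r - b, c'⁆ - ⁅s - b', c⁆ - ⁅c, c'⁆ - ⁅c, c'⁆) := by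
    simp only [add_lie, lie_add, sub_lie, lie_sub, hrb, hbs,
      ← lie_skew s a, ← lie_skew b' a, ← lie_skew s c, ← lie_skew b' c]
    abel
  rw [hZ, hR _ hp _ hm]
  simp only [add_lie, lie_add, sub_lie, lie_sub, hrs, hbb,
    ← lie_skew s a, ← lie_skew b' a, ← lie_skew s c, ← lie_skew b' c]
  abel
end

section
/- Let p,q ≥ 1, let k₊, k₋ ∈ ℂ be nonzero, and let β₊, β₋ : ℝ × ℝ → Matrix (Fin p) (Fin q) ℂ and γ₊, γ₋ : ℝ × ℝ → Matrix (Fin q) (Fin p) ℂ be differentiable matrix-valued functions. Define α₊ := −k₊⁻¹ · β₊γ₊ (a p×p matrix function) and δ₋ := −k₋⁻¹ · γ₋β₋ (a q×q matrix function). Assume that at every point: ∂₋β₊ = −(β₊δ₋ + k₊β₋), ∂₋γ₊ = δ₋γ₊ + k₊γ₋, ∂₊β₋ = α₊β₋ + k₋β₊, and ∂₊γ₋ = −(γ₋α₊ + k₋γ₊). Then at every point ∂₊δ₋ = γ₊β₋ − γ₋β₊ and ∂₋α₊ = β₋γ₊ − β₊γ₋. (The substitution α₊ = −k₊⁻¹β₊γ₊,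 δ₋ = −k₋⁻¹γ₋β₋ solves the remaining zero-curvature equation of the matrix Thirring system.) -/
open Matrix

/-- Entrywise partial derivative of a matrix-valued function on `ℝ × ℝ` with
respect to the first variable `x₊`. -/
noncomputable def pdPlus {m n : Type*} (f : ℝ × ℝ → Matrix m n ℂ) (z : ℝ × ℝ) :
    Matrix m n ℂ :=
  Matrix.of fun i j => fderiv ℝ (fun w => f w i j) z (1, 0)

/-- Entrywise partial derivative of a matrix-valued function on `ℝ × ℝ` with
respect to the second variable `x₋`. -/
noncomputable def pdMinus {m n : Type*} (f : ℝ × ℝ → Matrix m n ℂ) (z : ℝ × ℝ) :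
    Matrix m n ℂ :=
  Matrix.of fun i j => fderiv ℝ (fun w => f w i j) z (0, 1)

/-- Leibniz rule for the entrywise directional derivative of a scaled matrix product. -/
theorem fderiv_const_smul_matrix_mul_apply {E l m n : Type*} [NormedAddCommGroup E]
    [NormedSpace ℝ E] [Fintype m] (c : ℂ) {A : E → Matrix l m ℂ} {B : E → Matrix m n ℂ} {z : E}
    (hA : ∀ i j, DifferentiableAt ℝ (fun w => A w i j) z)
    (hB : ∀ i j, DifferentiableAt ℝ (fun w => B w i j) z) (v : E) (i : l) (j : n) :
    fderiv ℝ (fun w => (c • (A w * B w)) i j) z v =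
      (c • ((Matrix.of fun i j => fderiv ℝ (fun w => A w i j) z v) * B z +
        A z * Matrix.of fun i j => fderiv ℝ (fun w => B w i j) z v)) i j := by
  have h : HasFDerivAt (fun w => (c • (A w * B w)) i j)
      (c • ∑ k, (A z i k • fderiv ℝ (fun w => B w k j) z +
        B z k j • fderiv ℝ (fun w => A w i k) z)) z := by
    simp only [Matrix.smul_apply, Matrix.mul_apply]
    exact (HasFDerivAt.fun_sum fun k _ =>
      (hA i k).hasFDerivAt.mul (hB k j).hasFDerivAt).const_smul c
  rw [h.fderiv]
  simp [Matrix.mul_apply, Finset.sum_add_distrib, mul_add, mul_comm, add_comm]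

theorem pdPlus_const_smul_mul {l m n : Type*} [Fintype m] (c : ℂ) {A : ℝ × ℝ → Matrix l m ℂ}
    {B : ℝ × ℝ → Matrix m n ℂ} {z : ℝ × ℝ}
    (hA : ∀ i j, DifferentiableAt ℝ (fun w => A w i j) z)
    (hB : ∀ i j, DifferentiableAt ℝ (fun w => B w i j) z) :
    pdPlus (fun w => c • (A w * B w)) z = c • (pdPlus A z * B z + A z * pdPlus B z) := by
  ext i j
  exact fderiv_const_smul_matrix_mul_apply c hA hB (1, 0) i j

theorem pdMinus_const_smul_mul {l m n : Type*} [Fintype m] (c : ℂ) {A : ℝ × ℝ → Matrix l m ℂ}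
    {B : ℝ × ℝ → Matrix m n ℂ} {z : ℝ × ℝ}
    (hA : ∀ i j, DifferentiableAt ℝ (fun w => A w i j) z)
    (hB : ∀ i j, DifferentiableAt ℝ (fun w => B w i j) z) :
    pdMinus (fun w => c • (A w * B w)) z = c • (pdMinus A z * B z + A z * pdMinus B z) := by
  ext i j
  exact fderiv_const_smul_matrix_mul_apply c hA hB (0, 1) i j

/-- The terms containing `X` cancel when the Leibniz rule is applied along the flow. -/
theorem neg_inv_smul_leibniz_cancel {l m n : Type*} [Fintype m] {k : ℂ} (hk : k ≠ 0)
    (A C : Matrix l m ℂ) (B D : Matrix m n ℂ) (X : Matrix m m ℂ) :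
    -k⁻¹ • (-(A * X + k • C) * B + A * (X * B + k • D)) = C * B - A * D := by
  have h : -(A * X + k • C) * B + A * (X * B + k • D) = -k • (C * B - A * D) := by
    simp only [Matrix.neg_mul, Matrix.add_mul, Matrix.mul_add, Matrix.smul_mul, Matrix.mul_smul,
      Matrix.mul_assoc, neg_smul, smul_sub]
    abel
  rw [h, smul_smul, neg_mul_neg, inv_mul_cancel₀ hk, one_smul]

/-- The substitution `α₊ = -k₊⁻¹ β₊ γ₊`, `δ₋ = -k₋⁻¹ γ₋ β₋` solves the remaining
zero-curvature equations of the matrix Thirring system: if the four first-order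
matrix Thirring equations hold, then `∂₊δ₋ = γ₊β₋ - γ₋β₊` and
`∂₋α₊ = β₋γ₊ - β₊γ₋`. -/
theorem matrixThirring_substitution (p q : ℕ) (hp : 1 ≤ p) (hq : 1 ≤ q)
    (kp km : ℂ) (hkp : kp ≠ 0) (hkm : km ≠ 0)
    (βp βm : ℝ × ℝ → Matrix (Fin p) (Fin q) ℂ)
    (γp γm : ℝ × ℝ → Matrix (Fin q) (Fin p) ℂ)
    (hβp : ∀ i j, Differentiable ℝ fun w => βp w i j)
    (hβm : ∀ i j, Differentiable ℝ fun w => βm w i j)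
    (hγp : ∀ i j, Differentiable ℝ fun w => γp w i j)
    (hγm : ∀ i j, Differentiable ℝ fun w => γm w i j)
    (h1 : ∀ z, pdMinus βp z = -(βp z * (-km⁻¹ • (γm z * βm z)) + kp • βm z))
    (h2 : ∀ z, pdMinus γp z = (-km⁻¹ • (γm z * βm z)) * γp z + kp • γm z)
    (h3 : ∀ z, pdPlus βm z = (-kp⁻¹ • (βp z * γp z)) * βm z + km • βp z)
    (h4 : ∀ z, pdPlus γm z = -(γm z * (-kp⁻¹ • (βp z * γp z)) + km • γp z)) :
    ∀ z, pdPlus (fun w => -km⁻¹ • (γm w * βm w)) z = γp z * βm z - γm z * βp z ∧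
      pdMinus (fun w => -kp⁻¹ • (βp w * γp w)) z = βm z * γp z - βp z * γm z := by
  intro z
  constructor
  · rw [pdPlus_const_smul_mul _ (fun i j => hγm i j z) (fun i j => hβm i j z), h3, h4]
    exact neg_inv_smul_leibniz_cancel hkm _ _ _ _ _
  · rw [pdMinus_const_smul_mul _ (fun i j => hβp i j z) (fun i j => hγp i j z), h1, h2]
    exact neg_inv_smul_leibniz_cancel hkp _ _ _ _ _
end

section
/- Let p,q ≥ 1, n = p + q, and k₊, k₋ ∈ ℂ. Let α₊ : ℝ × ℝ → Matrix (Fin p) (Fin p) ℂ, δ₋ : ℝ × ℝ → Matrix (Fin q) (Fin q) ℂ, β₊, β₋ : ℝ × ℝ → Matrix (Fin p) (Fin q) ℂ, γ₊, γ₋ : ℝ × ℝ → Matrix (Fin q) (Fin p) ℂ be differentiable. Form the n×n block matrices E₊ = diag(1_p, 0), E₋ = diag(0, 1_q), A = diag(α₊, 0), D = diag(0, δ₋), B₊ = offdiag(β₊; γ₊), B₋ = offdiag(β₋; γ₋), and for u ∈ ℂ, u ≠ 0, set U(u) = k₊u²E₊ + uB₊ + A and V(u) = k₋u⁻²E₋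 + u⁻¹B₋ + D. Then the zero-curvature equation ∂₋U(u) − ∂₊V(u) + ⁅U(u), V(u)⁆ = 0 holds at a given point of ℝ × ℝ for ALL nonzero u ∈ ℂ if and only if at that point the six equations hold: ∂₋β₊ = −(β₊δ₋ + k₊β₋), ∂₋γ₊ = δ₋γ₊ + k₊γ₋, ∂₊β₋ = α₊β₋ + k₋β₊, ∂₊γ₋ = −(γ₋α₊ + k₋γ₊), ∂₊δ₋ = γ₊β₋ − γ₋β₊, and ∂₋α₊ = β₋γ₊ − β₊γ₋. -/
open Matrix

/-- The `U`-operator `U(u) = k₊u²E₊ + uB₊ + A` of the matrix Thirring system. -/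
noncomputable def Uop (p q : ℕ) (kp : ℂ)
    (αp : ℝ × ℝ → Matrix (Fin p) (Fin p) ℂ)
    (βp : ℝ × ℝ → Matrix (Fin p) (Fin q) ℂ)
    (γp : ℝ × ℝ → Matrix (Fin q) (Fin p) ℂ)
    (u : ℂ) (w : ℝ × ℝ) : Matrix (Fin p ⊕ Fin q) (Fin p ⊕ Fin q) ℂ :=
  (kp * u ^ 2) • fromBlocks (1 : Matrix (Fin p) (Fin p) ℂ) 0 0
      (0 : Matrix (Fin q) (Fin q) ℂ) +
    u • fromBlocks 0 (βp w) (γp w) 0 + fromBlocks (αp w) 0 0 0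

/-- The `V`-operator `V(u) = k₋u⁻²E₋ + u⁻¹B₋ + D` of the matrix Thirring system. -/
noncomputable def Vop (p q : ℕ) (km : ℂ)
    (δm : ℝ × ℝ → Matrix (Fin q) (Fin q) ℂ)
    (βm : ℝ × ℝ → Matrix (Fin p) (Fin q) ℂ)
    (γm : ℝ × ℝ → Matrix (Fin q) (Fin p) ℂ)
    (u : ℂ) (w : ℝ × ℝ) : Matrix (Fin p ⊕ Fin q) (Fin p ⊕ Fin q) ℂ :=
  (km * u⁻¹ ^ 2) • fromBlocks (0 : Matrix (Fin p) (Fin p) ℂ) 0 0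
      (1 : Matrix (Fin q) (Fin q) ℂ) +
    u⁻¹ • fromBlocks 0 (βm w) (γm w) 0 + fromBlocks 0 0 0 (δm w)

theorem eq_zero_of_forall_smul_add_inv_smul {M : Type*} [AddCommGroup M] [Module ℂ M]
    {X Y : M} (h : ∀ u : ℂ, u ≠ 0 → u • X + u⁻¹ • Y = 0) : X = 0 ∧ Y = 0 := by
  have h₁ : X + Y = 0 := by simpa using h 1 one_ne_zero
  have hY : Y = -X := (neg_eq_of_add_eq_zero_right h₁).symm
  have h₂ := h 2 two_ne_zero
  rw [hY, smul_neg, ← sub_eq_add_neg, ← sub_smul] at h₂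
  have hX : X = 0 := (smul_eq_zero.1 h₂).resolve_left (by norm_num)
  exact ⟨hX, by rw [hY, hX, neg_zero]⟩

theorem Uop_eq_fromBlocks (p q : ℕ) (kp : ℂ)
    (αp : ℝ × ℝ → Matrix (Fin p) (Fin p) ℂ)
    (βp : ℝ × ℝ → Matrix (Fin p) (Fin q) ℂ)
    (γp : ℝ × ℝ → Matrix (Fin q) (Fin p) ℂ) (u : ℂ) (w : ℝ × ℝ) :
    Uop p q kp αp βp γp u w =
      fromBlocks ((kp * u ^ 2) • 1 + αp w) (u • βp w) (u • γp w) 0 := by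
  simp [Uop, fromBlocks_smul, fromBlocks_add]

theorem Vop_eq_fromBlocks (p q : ℕ) (km : ℂ)
    (δm : ℝ × ℝ → Matrix (Fin q) (Fin q) ℂ)
    (βm : ℝ × ℝ → Matrix (Fin p) (Fin q) ℂ)
    (γm : ℝ × ℝ → Matrix (Fin q) (Fin p) ℂ) (u : ℂ) (w : ℝ × ℝ) :
    Vop p q km δm βm γm u w =
      fromBlocks 0 (u⁻¹ • βm w) (u⁻¹ • γm w) ((km * u⁻¹ ^ 2) • 1 + δm w) := by
  simp [Vop, fromBlocks_smul, fromBlocks_add]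

theorem pdMinus_Uop (p q : ℕ) (kp : ℂ)
    (αp : ℝ × ℝ → Matrix (Fin p) (Fin p) ℂ)
    (βp : ℝ × ℝ → Matrix (Fin p) (Fin q) ℂ)
    (γp : ℝ × ℝ → Matrix (Fin q) (Fin p) ℂ)
    (hβp : ∀ i j, Differentiable ℝ fun w => βp w i j)
    (hγp : ∀ i j, Differentiable ℝ fun w => γp w i j) (u : ℂ) (z : ℝ × ℝ) :
    pdMinus (Uop p q kp αp βp γp u) z =
      fromBlocks (pdMinus αp z) (u • pdMinus βp z) (u • pdMinus γp z) 0 := by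
  ext (i | i) (j | j)
  · simp [pdMinus, Uop_eq_fromBlocks, fderiv_const_add]
  · simp [pdMinus, Uop_eq_fromBlocks, fderiv_const_mul (hβp i j z)]
  · simp [pdMinus, Uop_eq_fromBlocks, fderiv_const_mul (hγp i j z)]
  · simp [pdMinus, Uop_eq_fromBlocks]

theorem pdPlus_Vop (p q : ℕ) (km : ℂ)
    (δm : ℝ × ℝ → Matrix (Fin q) (Fin q) ℂ)
    (βm : ℝ × ℝ → Matrix (Fin p) (Fin q) ℂ)
    (γm : ℝ × ℝ → Matrix (Fin q) (Fin p) ℂ)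
    (hβm : ∀ i j, Differentiable ℝ fun w => βm w i j)
    (hγm : ∀ i j, Differentiable ℝ fun w => γm w i j) (u : ℂ) (z : ℝ × ℝ) :
    pdPlus (Vop p q km δm βm γm u) z =
      fromBlocks 0 (u⁻¹ • pdPlus βm z) (u⁻¹ • pdPlus γm z) (pdPlus δm z) := by
  ext (i | i) (j | j)
  · simp [pdPlus, Vop_eq_fromBlocks]
  · simp [pdPlus, Vop_eq_fromBlocks, fderiv_const_mul (hβm i j z)]
  · simp [pdPlus, Vop_eq_fromBlocks, fderiv_const_mul (hγm i j z)]
  · simp [pdPlus, Vop_eq_fromBlocks, fderiv_const_add]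

/-- The zero-curvature equation `∂₋U(u) - ∂₊V(u) + ⁅U(u), V(u)⁆ = 0` of the block
Thirring `U`-`V` pair holds at a point for all nonzero `u ∈ ℂ` if and only if the
six matrix Thirring equations hold at that point. -/
theorem matrixThirring_zero_curvature_iff (p q : ℕ) (hp : 1 ≤ p) (hq : 1 ≤ q)
    (kp km : ℂ)
    (αp : ℝ × ℝ → Matrix (Fin p) (Fin p) ℂ)
    (δm : ℝ × ℝ → Matrix (Fin q) (Fin q) ℂ)
    (βp βm : ℝ × ℝ → Matrix (Fin p) (Fin q) ℂ)
    (γp γm : ℝ × ℝ → Matrix (Fin q) (Fin p) ℂ)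
    (hαp : ∀ i j, Differentiable ℝ fun w => αp w i j)
    (hδm : ∀ i j, Differentiable ℝ fun w => δm w i j)
    (hβp : ∀ i j, Differentiable ℝ fun w => βp w i j)
    (hβm : ∀ i j, Differentiable ℝ fun w => βm w i j)
    (hγp : ∀ i j, Differentiable ℝ fun w => γp w i j)
    (hγm : ∀ i j, Differentiable ℝ fun w => γm w i j)
    (z : ℝ × ℝ) :
    (∀ u : ℂ, u ≠ 0 →
        pdMinus (Uop p q kp αp βp γp u) z - pdPlus (Vop p q km δm βm γm u) z +
          ⁅Uop p q kp αp βp γp u z, Vop p q km δm βm γm u z⁆ = 0) ↔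
      (pdMinus βp z = -(βp z * δm z + kp • βm z) ∧
       pdMinus γp z = δm z * γp z + kp • γm z ∧
       pdPlus βm z = αp z * βm z + km • βp z ∧
       pdPlus γm z = -(γm z * αp z + km • γp z) ∧
       pdPlus δm z = γp z * βm z - γm z * βp z ∧
       pdMinus αp z = βm z * γp z - βp z * γm z) := by
  have hblocks : ∀ u : ℂ, u ≠ 0 →
      pdMinus (Uop p q kp αp βp γp u) z - pdPlus (Vop p q km δm βm γm u) z +
          ⁅Uop p q kp αp βp γp u z, Vop p q km δm βm γm u z⁆ =
        fromBlocks (pdMinus αp z - (βm z * γp z - βp z * γm z))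
          (u • (pdMinus βp z - -(βp z * δm z + kp • βm z)) +
            u⁻¹ • (αp z * βm z + km • βp z - pdPlus βm z))
          (u • (pdMinus γp z - (δm z * γp z + kp • γm z)) +
            u⁻¹ • (-(γm z * αp z + km • γp z) - pdPlus γm z))
          (γp z * βm z - γm z * βp z - pdPlus δm z) := by
    intro u hu
    have hkp : u⁻¹ * (kp * u ^ 2) = u * kp := by field_simp
    have hkm : u * (km * (u ^ 2)⁻¹) = u⁻¹ * km := by field_simp
    have hkp' : kp * u ^ 2 * u⁻¹ = u * kp := by field_simp
    have hkm' : km * (u ^ 2)⁻¹ * u = u⁻¹ * km := by field_simp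
    rw [pdMinus_Uop p q kp αp βp γp hβp hγp, pdPlus_Vop p q km δm βm γm hβm hγm,
      Uop_eq_fromBlocks, Vop_eq_fromBlocks, Ring.lie_def, fromBlocks_multiply,
      fromBlocks_multiply]
    simp only [sub_eq_add_neg, fromBlocks_neg, fromBlocks_add]
    congr 1
    · simp [smul_smul, hu]
    · simp [smul_smul, Matrix.add_mul, Matrix.mul_add, hkp, hkm']
      abel
    · simp [smul_smul, Matrix.add_mul, Matrix.mul_add, hkp', hkm]
      abel
    · simp [smul_smul, hu]
      abel
  rw [forall₂_congr fun u hu => by rw [hblocks u hu, ← fromBlocks_zero, fromBlocks_inj]]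
  constructor
  · intro h
    obtain ⟨hα, -, -, hδ⟩ := h 1 one_ne_zero
    obtain ⟨hβplus, hβminus⟩ := eq_zero_of_forall_smul_add_inv_smul fun u hu => (h u hu).2.1
    obtain ⟨hγplus, hγminus⟩ := eq_zero_of_forall_smul_add_inv_smul fun u hu => (h u hu).2.2.1
    exact ⟨sub_eq_zero.1 hβplus, sub_eq_zero.1 hγplus, (sub_eq_zero.1 hβminus).symm,
      (sub_eq_zero.1 hγminus).symm, (sub_eq_zero.1 hδ).symm, sub_eq_zero.1 hα⟩
  · rintro ⟨hβplus, hγplus, hβminus, hγminus, hδ, hα⟩ u -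
    rw [hβplus, hγplus, hβminus, hγminus, hδ, hα]
    simp
end

section
/- Let c ∈ ℝ be nonzero, let k₊, k₋ ∈ ℝ be nonzero with k₊ + k₋ = 1, and let ψ₊, ψ₋ : ℝ × ℝ → ℂ be differentiable. Set α⁽⁰⁾ = i·c, β⁽¹⁾ = ψ₊, β⁽⁻¹⁾ = ψ₋, γ⁽¹⁾ = −conj(ψ₊), γ⁽⁻¹⁾ = −conj(ψ₋), α⁽²⁾ = −(β⁽¹⁾γ⁽¹⁾)/(2k₊α⁽⁰⁾), and α⁽⁻²⁾ = −(β⁽⁻¹⁾γ⁽⁻¹⁾)/(2k₋α⁽⁰⁾). Then the sl(2) Thirring system ∂₋γ⁽¹⁾ = 2k₊α⁽⁰⁾γ⁽⁻¹⁾ − 2k₋α⁽⁻²⁾γ⁽¹⁾, ∂₋β⁽¹⁾ = −2k₊α⁽⁰⁾β⁽⁻¹⁾ + 2k₋α⁽⁻²⁾β⁽¹⁾, ∂₊γ⁽⁻¹⁾ = 2k₋α⁽⁰⁾γ⁽¹⁾ − 2k₊α⁽²⁾γ⁽⁻¹⁾, ∂₊β⁽⁻¹⁾ = −2k₋α⁽⁰⁾β⁽¹⁾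 + 2k₊α⁽²⁾β⁽⁻¹⁾ holds at every point if and only if the massive Thirring equations hold at every point: i·c·∂₋ψ₊ = 2k₊c²ψ₋ + |ψ₋|²ψ₊ and i·c·∂₊ψ₋ = 2k₋c²ψ₊ + |ψ₊|²ψ₋. -/
open ComplexConjugate

/-- Partial derivative of a complex-valued function on `ℝ × ℝ` with respect to
the first variable `x₊`. -/
noncomputable def dP (f : ℝ × ℝ → ℂ) (z : ℝ × ℝ) : ℂ := fderiv ℝ f z (1, 0)

/-- Partial derivative of a complex-valued function on `ℝ × ℝ` with respect to
the second variable `x₋`. -/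
noncomputable def dM (f : ℝ × ℝ → ℂ) (z : ℝ × ℝ) : ℂ := fderiv ℝ f z (0, 1)

theorem fderiv_neg_conj_apply {f : ℝ × ℝ → ℂ} {z : ℝ × ℝ} (hf : DifferentiableAt ℝ f z)
    (v : ℝ × ℝ) : fderiv ℝ (fun w => -conj (f w)) z v = -conj (fderiv ℝ f z v) := by
  have h : HasFDerivAt (fun w => -conj (f w))
      (-((Complex.conjCLE : ℂ →L[ℝ] ℂ).comp (fderiv ℝ f z))) z :=
    ((Complex.conjCLE : ℂ →L[ℝ] ℂ).hasFDerivAt.comp z hf.hasFDerivAt).neg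
  rw [h.fderiv]
  simp

/-- The equation for `β` is the massive Thirring equation divided by `ic`. -/
theorem beta_equation_iff {c l : ℝ} (hc : c ≠ 0) (hl : l ≠ 0) (k : ℝ) (d a b : ℂ) :
    d = -(2 * (k : ℂ) * (Complex.I * (c : ℂ))) * b +
        2 * (l : ℂ) * (-(b * (-conj b)) / (2 * (l : ℂ) * (Complex.I * (c : ℂ)))) * a ↔
      Complex.I * (c : ℂ) * d = 2 * (k : ℂ) * (c : ℂ) ^ 2 * b + b * conj b * a := by
  have hc' : (c : ℂ) ≠ 0 := Complex.ofReal_ne_zero.mpr hc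
  have hl' : (l : ℂ) ≠ 0 := Complex.ofReal_ne_zero.mpr hl
  have hIc : Complex.I * (c : ℂ) ≠ 0 := mul_ne_zero Complex.I_ne_zero hc'
  rw [← mul_right_inj' hIc]
  have h : Complex.I * (c : ℂ) * (-(2 * (k : ℂ) * (Complex.I * (c : ℂ))) * b +
        2 * (l : ℂ) * (-(b * (-conj b)) / (2 * (l : ℂ) * (Complex.I * (c : ℂ)))) * a) =
      2 * (k : ℂ) * (c : ℂ) ^ 2 * b + b * conj b * a := by
    have hI := Complex.I_ne_zero
    field_simp
    linear_combination (-2 * (k : ℂ) * (c : ℂ) ^ 2 * b) * Complex.I_sq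
  rw [h]

/-- The equation for `γ` is the negated complex conjugate of the equation for `β`. -/
theorem gamma_equation_iff_beta_equation (c k l : ℝ) (d a b : ℂ) :
    -conj d = 2 * (k : ℂ) * (Complex.I * (c : ℂ)) * (-conj b) -
        2 * (l : ℂ) * (-(b * (-conj b)) / (2 * (l : ℂ) * (Complex.I * (c : ℂ)))) * (-conj a) ↔
      d = -(2 * (k : ℂ) * (Complex.I * (c : ℂ))) * b +
        2 * (l : ℂ) * (-(b * (-conj b)) / (2 * (l : ℂ) * (Complex.I * (c : ℂ)))) * a := by
  rw [← (starRingEnd ℂ).injective.eq_iff (a := d), ← neg_inj (a := conj d)]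
  have h : -conj (-(2 * (k : ℂ) * (Complex.I * (c : ℂ))) * b +
        2 * (l : ℂ) * (-(b * (-conj b)) / (2 * (l : ℂ) * (Complex.I * (c : ℂ)))) * a) =
      2 * (k : ℂ) * (Complex.I * (c : ℂ)) * (-conj b) -
        2 * (l : ℂ) * (-(b * (-conj b)) / (2 * (l : ℂ) * (Complex.I * (c : ℂ)))) *
          (-conj a) := by
    simp only [map_add, map_mul, map_neg, map_div₀, Complex.conj_I, Complex.conj_ofReal,
      Complex.conj_conj, map_ofNat, mul_neg, neg_mul, div_neg]
    ring
  rw [h]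

/-- With `α⁽⁰⁾ = ic`, `β⁽±¹⁾ = ψ±`, `γ⁽±¹⁾ = -conj ψ±`,
`α⁽±²⁾ = -(β⁽±¹⁾γ⁽±¹⁾)/(2k±α⁽⁰⁾)`, the `sl(2)` Thirring system holds at every
point if and only if the usual massive Thirring equations
`ic∂₋ψ₊ = 2k₊c²ψ₋ + |ψ₋|²ψ₊`, `ic∂₊ψ₋ = 2k₋c²ψ₊ + |ψ₊|²ψ₋` hold at every point. -/
theorem sl2Thirring_iff_massiveThirring (c kp km : ℝ)
    (hc : c ≠ 0) (hkp : kp ≠ 0) (hkm : km ≠ 0) (hk : kp + km = 1)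
    (ψp ψm : ℝ × ℝ → ℂ)
    (hψp : Differentiable ℝ ψp) (hψm : Differentiable ℝ ψm) :
    (∀ z : ℝ × ℝ,
        dM (fun w => -conj (ψp w)) z =
            2 * (kp : ℂ) * (Complex.I * (c : ℂ)) * (-conj (ψm z)) -
              2 * (km : ℂ) *
                (-(ψm z * (-conj (ψm z))) / (2 * (km : ℂ) * (Complex.I * (c : ℂ)))) *
                (-conj (ψp z)) ∧
        dM ψp z =
            -(2 * (kp : ℂ) * (Complex.I * (c : ℂ))) * ψm z +
              2 * (km : ℂ) *
                (-(ψm z * (-conj (ψm z))) / (2 * (km : ℂ) * (Complex.I * (c : ℂ)))) *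
                ψp z ∧
        dP (fun w => -conj (ψm w)) z =
            2 * (km : ℂ) * (Complex.I * (c : ℂ)) * (-conj (ψp z)) -
              2 * (kp : ℂ) *
                (-(ψp z * (-conj (ψp z))) / (2 * (kp : ℂ) * (Complex.I * (c : ℂ)))) *
                (-conj (ψm z)) ∧
        dP ψm z =
            -(2 * (km : ℂ) * (Complex.I * (c : ℂ))) * ψp z +
              2 * (kp : ℂ) *
                (-(ψp z * (-conj (ψp z))) / (2 * (kp : ℂ) * (Complex.I * (c : ℂ)))) *
                ψm z) ↔
    (∀ z : ℝ × ℝ,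
        Complex.I * (c : ℂ) * dM ψp z =
            2 * (kp : ℂ) * (c : ℂ) ^ 2 * ψm z + ψm z * conj (ψm z) * ψp z ∧
        Complex.I * (c : ℂ) * dP ψm z =
            2 * (km : ℂ) * (c : ℂ) ^ 2 * ψp z + ψp z * conj (ψp z) * ψm z) := by
  refine forall_congr' fun z => ?_
  have hp : dM (fun w => -conj (ψp w)) z = -conj (dM ψp z) :=
    fderiv_neg_conj_apply (hψp z) (0, 1)
  have hm : dP (fun w => -conj (ψm w)) z = -conj (dP ψm z) :=
    fderiv_neg_conj_apply (hψm z) (1, 0)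
  rw [hp, hm, gamma_equation_iff_beta_equation, gamma_equation_iff_beta_equation,
    beta_equation_iff hc hkm, beta_equation_iff hc hkp]
  tauto
end

section
/- Let c ∈ ℝ be nonzero and set α⁽⁰⁾ = i·c. Let β⁽¹⁾ : ℝ × ℝ → ℂ be twice continuously differentiable and β⁽⁻¹⁾ : ℝ × ℝ → ℂ be differentiable, and set γ⁽¹⁾ = −conj(β⁽¹⁾) and α⁽²⁾ = −(β⁽¹⁾γ⁽¹⁾)/(2α⁽⁰⁾). Assume that at every point ∂₋β⁽¹⁾ = −2α⁽⁰⁾β⁽⁻¹⁾ and ∂₊β⁽⁻¹⁾ = 2α⁽²⁾β⁽⁻¹⁾. Then ψ := β⁽¹⁾ satisfies the second-order equation ∂₊∂₋ψ + (i/c)·|ψ|²·∂₋ψ = 0 at every point (the integrable equation intermediate between the Thirring and sine-Gordon equations). -/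
open ComplexConjugate

/-- With `α⁽⁰⁾ = ic`, `γ⁽¹⁾ = -conj β⁽¹⁾`, `α⁽²⁾ = -(β⁽¹⁾γ⁽¹⁾)/(2α⁽⁰⁾)`, a
solution of `∂₋β⁽¹⁾ = -2α⁽⁰⁾β⁽⁻¹⁾`, `∂₊β⁽⁻¹⁾ = 2α⁽²⁾β⁽⁻¹⁾` gives a solution
`ψ = β⁽¹⁾` of the second-order equation `∂₊∂₋ψ + (i/c)|ψ|²∂₋ψ = 0`, the
integrable equation intermediate between the Thirring and sine-Gordon
equations. -/
theorem intermediate_thirring_sineGordon (c : ℝ) (hc : c ≠ 0)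
    (β1 βm1 : ℝ × ℝ → ℂ)
    (hβ1 : ContDiff ℝ 2 β1) (hβm1 : Differentiable ℝ βm1)
    (h1 : ∀ z, dM β1 z = -(2 * (Complex.I * (c : ℂ))) * βm1 z)
    (h2 : ∀ z, dP βm1 z =
        2 * (-(β1 z * (-conj (β1 z))) / (2 * (Complex.I * (c : ℂ)))) * βm1 z) :
    ∀ z, dP (fun w => dM β1 w) z +
        Complex.I / (c : ℂ) * (β1 z * conj (β1 z)) * dM β1 z = 0 := by
  intro z
  have hdP : dP (fun w => dM β1 w) z = -(2 * (Complex.I * (c : ℂ))) * dP βm1 z := by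
    simp only [dP, funext h1]
    rw [fderiv_const_mul (hβm1 z)]
    rfl
  have hc' : (c : ℂ) ≠ 0 := Complex.ofReal_ne_zero.mpr hc
  rw [hdP, h1, h2]
  field_simp [Complex.I_ne_zero]
  linear_combination (-2 * β1 z * conj (β1 z) * βm1 z) * Complex.I_sq
end
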